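/- Let n ≥ 2 be an integer and let α_k (for k = 2−n, …, −1 and k = 1, 2, 3), β_k (for k = 2−n, …, 1) and γ_0, γ_1 be real numbers, not all zero, and define on (0,1) the function F(h) = Σ_{k=1}^{3} α_k (h^{k/2} − 1) + Σ_{k=2−n}^{−1} α_k (h^{k+1/2} − 1) + √(1−h) Σ_{k=2−n}^{1} β_k h^k + (γ_0 + γ_1 h) · ln((1+√(1−h))/(1−√(1−h))). Then F has at most 2n+2 zeros in (0,1), and there exists a choice of the coefficients for which F has at least 2n+2 distinct zeros in (0,1). -/

import Mathlib

open Real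

/-- The function `F` of Statement 14, depending on `n` and the coefficients
`α_k` (`k = 2−n,…,−1` and `k = 1,2,3`), `β_k` (`k = 2−n,…,1`) and `γ_0, γ_1`. -/
noncomputable def F14 (n : ℕ) (α β : ℤ → ℝ) (γ0 γ1 : ℝ) (h : ℝ) : ℝ :=
  (∑ k ∈ Finset.Icc (1 : ℤ) 3, α k * (h ^ ((k : ℝ) / 2) - 1))
    + (∑ k ∈ Finset.Icc (2 - (n : ℤ)) (-1), α k * (h ^ ((k : ℝ) + 1 / 2) - 1))
    + Real.sqrt (1 - h) * (∑ k ∈ Finset.Icc (2 - (n : ℤ)) 1, β k * h ^ k)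
    + (γ0 + γ1 * h) *
        Real.log ((1 + Real.sqrt (1 - h)) / (1 - Real.sqrt (1 - h)))

theorem Polynomial.card_pos_roots_le_of_coeff_eq_zero {W : Polynomial ℝ} (hW : W ≠ 0) {M : ℕ}
    (hdeg : W.natDegree ≤ M + 1) (hM : W.coeff M = 0) (S : Finset ℝ)
    (hS : ∀ t ∈ S, 0 < t ∧ W.eval t = 0) : S.card ≤ M := by
  by_contra! hlt
  have hle : S.val ≤ W.roots := by
    rw [Finset.val_le_iff_val_subset]
    intro t ht
    exact (Polynomial.mem_roots hW).2 (hS t ht).2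
  have hcard : W.roots.card ≤ W.natDegree := W.card_roots'
  have hSW : S.card ≤ W.roots.card := Multiset.card_le_card hle
  have heq : S.val = W.roots :=
    Multiset.eq_of_le_of_card_le hle (by change _ ≤ S.card; omega)
  have hsplit : W.Splits := Polynomial.splits_iff_card_roots.2 (by omega)
  have hd : W.natDegree = M + 1 := by omega
  have hnext := hsplit.nextCoeff_eq_neg_sum_roots_mul_leadingCoeff
  rw [Polynomial.nextCoeff_of_natDegree_pos (by omega), hd, Nat.add_sub_cancel, hM, ← heq] at hnext
  have hpos : 0 < S.val.sum := by
    have : S.val.sum = ∑ t ∈ S, t := (Finset.sum_val S).symm ▸ rfl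
    rw [this]
    exact Finset.sum_pos (fun t ht => (hS t ht).1) (Finset.card_pos.1 (by omega))
  have hlead : W.leadingCoeff ≠ 0 := Polynomial.leadingCoeff_ne_zero.2 hW
  have := mul_ne_zero (neg_ne_zero.2 hlead) hpos.ne'
  exact this hnext.symm

/-- The polynomial `(1 + X) ^ m * P (X / (1 + X))`, for `P` of degree at most `m`. -/
noncomputable def Polynomial.projTransform (m : ℕ) (P : Polynomial ℝ) : Polynomial ℝ :=
  ∑ i ∈ Finset.range (m + 1),
    Polynomial.C (P.coeff i) * Polynomial.X ^ i * (1 + Polynomial.X) ^ (m - i)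

theorem Polynomial.eval_projTransform {m : ℕ} {P : Polynomial ℝ} (hP : P.natDegree ≤ m) {x : ℝ}
    (hx : 1 + x ≠ 0) :
    (P.projTransform m).eval x = (1 + x) ^ m * P.eval (x / (1 + x)) := by
  rw [Polynomial.projTransform, Polynomial.eval_finsetSum,
    Polynomial.eval_eq_sum_range' (Nat.lt_succ_of_le hP), Finset.mul_sum]
  refine Finset.sum_congr rfl fun i hi => ?_
  have hi' : i ≤ m := Nat.lt_succ_iff.1 (Finset.mem_range.1 hi)
  obtain ⟨j, rfl⟩ := Nat.exists_eq_add_of_le hi'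
  simp only [Polynomial.eval_mul, Polynomial.eval_C, Polynomial.eval_pow, Polynomial.eval_X,
    Polynomial.eval_add, Polynomial.eval_one, Nat.add_sub_cancel_left, div_pow, pow_add]
  field_simp

theorem Polynomial.natDegree_projTransform_le (m : ℕ) (P : Polynomial ℝ) :
    (P.projTransform m).natDegree ≤ m := by
  refine Polynomial.natDegree_sum_le_of_forall_le _ _ fun i hi => ?_
  have hi' : i ≤ m := Nat.lt_succ_iff.1 (Finset.mem_range.1 hi)
  have h1 : (1 + Polynomial.X : Polynomial ℝ).natDegree ≤ 1 := by compute_degree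
  have h2 := Polynomial.natDegree_pow_le_of_le (m - i) h1
  have h3 := Polynomial.natDegree_C_mul_X_pow_le (P.coeff i) i
  have := Polynomial.natDegree_mul_le_of_le h3 h2
  omega

theorem Polynomial.eq_zero_of_projTransform_eq_zero {m : ℕ} {P : Polynomial ℝ}
    (hP : P.natDegree ≤ m) (h : P.projTransform m = 0) : P = 0 := by
  refine Polynomial.eq_of_infinite_eval_eq P 0 ?_
  refine (Set.Ioo_infinite (zero_lt_one (α := ℝ))).mono fun y hy => ?_
  have hy1 : 0 < 1 - y := sub_pos.2 hy.2
  have hx : 1 + y / (1 - y) = 1 / (1 - y) := by field_simp; ring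
  have hne : 1 + y / (1 - y) ≠ 0 := by rw [hx]; positivity
  have he := Polynomial.eval_projTransform hP hne
  rw [h, Polynomial.eval_zero, eq_comm, mul_eq_zero] at he
  have hq : y / (1 - y) / (1 + y / (1 - y)) = y := by rw [hx]; field_simp
  rw [hq] at he
  simpa using he.resolve_left (pow_ne_zero _ hne)

/-- The bound on zeros comes from the substitution `h = t ^ 2 / (1 + t ^ 2)`, which turns the
function into a polynomial in `t` of degree `2 * N + 6` without the next-to-leading term. -/
theorem card_zeros_sqrt_mul_add_le {N : ℕ} {P Q : Polynomial ℝ} (hP : P.natDegree ≤ N + 1)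
    (hQ : Q.natDegree ≤ N + 3) (hPQ : ¬ (P = 0 ∧ Q = 0)) (S : Finset ℝ)
    (hS : ∀ h ∈ S, h ∈ Set.Ioo (0 : ℝ) 1 ∧
      √h * √(1 - h) ^ 3 * P.eval h + Q.eval h = 0) : S.card ≤ 2 * N + 5 := by
  set U := P.projTransform (N + 1) with hU
  set V := Q.projTransform (N + 3) with hV
  have hUd : U.natDegree ≤ N + 1 := Polynomial.natDegree_projTransform_le _ _
  have hVd : V.natDegree ≤ N + 3 := Polynomial.natDegree_projTransform_le _ _
  set W : Polynomial ℝ :=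
    Polynomial.X * Polynomial.expand ℝ 2 U + Polynomial.expand ℝ 2 V with hWdef
  have hodd : ∀ k, W.coeff (2 * k + 1) = U.coeff k := fun k => by
    rw [hWdef, Polynomial.coeff_add, Polynomial.coeff_X_mul,
      Polynomial.coeff_expand_mul' two_pos, Polynomial.coeff_expand two_pos,
      if_neg (by omega), add_zero]
  have heven : ∀ k, W.coeff (2 * k) = V.coeff k := fun k => by
    rw [hWdef, Polynomial.coeff_add, Polynomial.coeff_expand_mul' two_pos]
    rcases k with _ | k
    · simp
    · rw [show 2 * (k + 1) = (2 * k + 1) + 1 by ring, Polynomial.coeff_X_mul,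
        Polynomial.coeff_expand two_pos, if_neg (by omega), zero_add]
  have hW : W ≠ 0 := by
    intro h0
    refine hPQ ⟨Polynomial.eq_zero_of_projTransform_eq_zero hP ?_,
      Polynomial.eq_zero_of_projTransform_eq_zero hQ ?_⟩
    · ext k
      rw [← hU, ← hodd, h0, Polynomial.coeff_zero, Polynomial.coeff_zero]
    · ext k
      rw [← hV, ← heven, h0, Polynomial.coeff_zero, Polynomial.coeff_zero]
  have hdeg : W.natDegree ≤ (2 * N + 5) + 1 := by
    refine Polynomial.natDegree_add_le_of_degree_le ?_ ?_
    · refine (Polynomial.natDegree_mul_le_of_le (m := 1) (n := 2 * N + 5)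
        Polynomial.natDegree_X_le ?_).trans (by omega)
      rw [Polynomial.natDegree_expand]
      omega
    · rw [Polynomial.natDegree_expand]
      omega
  have hco : W.coeff (2 * N + 5) = 0 := by
    rw [show 2 * N + 5 = 2 * (N + 2) + 1 by ring, hodd]
    exact Polynomial.coeff_eq_zero_of_natDegree_lt (by omega)
  have hinj : Set.InjOn (fun h : ℝ => √h / √(1 - h)) S := by
    intro x hx y hy hxy
    obtain ⟨⟨hx0, hx1⟩, -⟩ := hS x hx
    obtain ⟨⟨hy0, hy1⟩, -⟩ := hS y hy
    have h2 : (√x / √(1 - x)) ^ 2 = (√y / √(1 - y)) ^ 2 := by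
      simpa using congrArg (· ^ 2) hxy
    have hx1' : 0 < 1 - x := by linarith
    have hy1' : 0 < 1 - y := by linarith
    rw [div_pow, div_pow, sq_sqrt hx0.le, sq_sqrt hy0.le, sq_sqrt hx1'.le, sq_sqrt hy1'.le,
      div_eq_div_iff hx1'.ne' hy1'.ne'] at h2
    linarith
  rw [← Finset.card_image_of_injOn hinj]
  refine Polynomial.card_pos_roots_le_of_coeff_eq_zero hW hdeg hco _ fun t ht => ?_
  obtain ⟨h, hh, rfl⟩ := Finset.mem_image.1 ht
  obtain ⟨⟨h0, h1⟩, hz⟩ := hS h hh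
  have h1' : 0 < 1 - h := sub_pos.2 h1
  have hr : 0 < √h := sqrt_pos.2 h0
  have hs : 0 < √(1 - h) := sqrt_pos.2 h1'
  have hs2 : √(1 - h) ^ 2 = 1 - h := sq_sqrt h1'.le
  refine ⟨by positivity, ?_⟩
  have ht2 : (√h / √(1 - h)) ^ 2 = h / (1 - h) := by rw [div_pow, sq_sqrt h0.le, hs2]
  have hx : 1 + h / (1 - h) = 1 / (1 - h) := by field_simp; ring
  have hx' : 1 + h / (1 - h) = 1 / √(1 - h) ^ 2 := by rw [hs2, hx]
  have hne : 1 + h / (1 - h) ≠ 0 := by rw [hx]; positivity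
  have hq : h / (1 - h) / (1 + h / (1 - h)) = h := by rw [hx]; field_simp
  rw [hWdef, Polynomial.eval_add, Polynomial.eval_mul, Polynomial.eval_X, Polynomial.expand_eval,
    Polynomial.expand_eval, ht2, hU, hV, Polynomial.eval_projTransform hP hne,
    Polynomial.eval_projTransform hQ hne, hq, hx']
  have : √h / √(1 - h) * ((1 / √(1 - h) ^ 2) ^ (N + 1) * P.eval h)
      + (1 / √(1 - h) ^ 2) ^ (N + 3) * Q.eval h
      = (1 / √(1 - h) ^ 2) ^ (N + 3) *
        (√h * √(1 - h) ^ 3 * P.eval h + Q.eval h) := by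
    rw [show N + 3 = (N + 1) + 2 by ring, pow_add _ (N + 1) 2]
    field_simp
  rw [this, hz, mul_zero]

theorem exists_finset_zeros_deriv {f f' : ℝ → ℝ} {s : Set ℝ} (hs : s.OrdConnected)
    (hf : ContinuousOn f s) (hf' : ∀ x ∈ interior s, HasDerivAt f (f' x) x) (S : Finset ℝ)
    (hS : ∀ x ∈ S, x ∈ s ∧ f x = 0) :
    ∃ T : Finset ℝ, (∀ x ∈ T, x ∈ interior s ∧ f' x = 0) ∧ S.card ≤ T.card + 1 := by
  have key : ∀ p : ℝ × ℝ, ∃ z, p.1 ∈ S → p.2 ∈ S → p.1 < p.2 →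
      z ∈ Set.Ioo p.1 p.2 ∧ z ∈ interior s ∧ f' z = 0 := by
    rintro ⟨x, y⟩
    by_cases h : x ∈ S ∧ y ∈ S ∧ x < y
    · obtain ⟨hx, hy, hxy⟩ := h
      have hsub : Set.Icc x y ⊆ s := hs.out (hS x hx).1 (hS y hy).1
      have hint : Set.Ioo x y ⊆ interior s :=
        interior_maximal (Set.Ioo_subset_Icc_self.trans hsub) isOpen_Ioo
      obtain ⟨z, hz, hz0⟩ := exists_hasDerivAt_eq_zero hxy (hf.mono hsub)
        ((hS x hx).2.trans (hS y hy).2.symm) fun z hz => hf' z (hint hz)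
      exact ⟨z, fun _ _ _ => ⟨hz, hint hz, hz0⟩⟩
    · exact ⟨0, fun h1 h2 h3 => (h ⟨h1, h2, h3⟩).elim⟩
  choose g hg using key
  refine ⟨((S ×ˢ S).filter fun p => p.1 < p.2).image g, fun z hz => ?_,
    Finset.card_le_of_interleaved fun x hx y hy hxy _ => ?_⟩
  · obtain ⟨p, hp, rfl⟩ := Finset.mem_image.1 hz
    simp only [Finset.mem_filter, Finset.mem_product] at hp
    exact (hg p hp.1.1 hp.1.2 hp.2).2
  · have := (hg (x, y) hx hy hxy).1
    exact ⟨g (x, y), Finset.mem_image_of_mem _ (by simp [hx, hy, hxy]), this.1, this.2⟩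

/-- `F14` with the summation indices shifted to start at `0`; here `n = N + 2`, the coefficients
`a` belong to the half-integer powers and `c` is the coefficient of `h - 1`. -/
noncomputable def F14Shift (N : ℕ) (a b : ℕ → ℝ) (c γ0 γ1 h : ℝ) : ℝ :=
  (∑ i ∈ Finset.range (N + 2), a i * (h ^ ((i : ℝ) - N + 1 / 2) - 1)) + c * (h - 1)
    + (∑ i ∈ Finset.range (N + 2), b i * (√(1 - h) * h ^ ((i : ℝ) - N)))
    + (γ0 + γ1 * h) * log ((1 + √(1 - h)) / (1 - √(1 - h)))

theorem sum_Icc_int_eq_sum_range (f : ℤ → ℝ) (c : ℤ) (m : ℕ) :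
    ∑ k ∈ Finset.Icc c (c + m - 1), f k = ∑ i ∈ Finset.range m, f (c + i) := by
  refine Finset.sum_nbij' (fun k => (k - c).toNat) (fun i => c + i) ?_ ?_ ?_ ?_ ?_
  · intro k hk
    simp only [Finset.mem_Icc, Finset.mem_range] at *
    omega
  · intro i hi
    simp only [Finset.mem_Icc, Finset.mem_range] at *
    omega
  · intro k hk
    simp only [Finset.mem_Icc] at *
    omega
  · intro i hi
    simp
  · intro k hk
    simp only [Finset.mem_Icc] at hk
    congr 1
    omega

/-- The coefficients of the half-integer powers, listed by increasing exponent. -/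
noncomputable def halfPowCoeff (N : ℕ) (α : ℤ → ℝ) (i : ℕ) : ℝ :=
  if i < N then α (i - N) else if i = N then α 1 else α 3

theorem F14_eq_F14Shift (N : ℕ) (α β : ℤ → ℝ) (γ0 γ1 h : ℝ) :
    F14 (N + 2) α β γ0 γ1 h =
      F14Shift N (halfPowCoeff N α) (fun i => β (i - N)) (α 2) γ0 γ1 h := by
  have h1 : ∑ k ∈ Finset.Icc (1 : ℤ) 3, α k * (h ^ ((k : ℝ) / 2) - 1)
      = α 1 * (h ^ ((1 : ℝ) / 2) - 1) + α 2 * (h - 1) + α 3 * (h ^ ((3 : ℝ) / 2) - 1) := by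
    have := sum_Icc_int_eq_sum_range (fun k => α k * (h ^ ((k : ℝ) / 2) - 1)) 1 3
    norm_num [Finset.sum_range_succ] at this
    norm_num [this]
  have h2 : ∑ k ∈ Finset.Icc (2 - ((N + 2 : ℕ) : ℤ)) (-1), α k * (h ^ ((k : ℝ) + 1 / 2) - 1)
      = ∑ i ∈ Finset.range N, α (i - N) * (h ^ ((i : ℝ) - N + 1 / 2) - 1) := by
    have := sum_Icc_int_eq_sum_range (fun k => α k * (h ^ ((k : ℝ) + 1 / 2) - 1)) (-N) N
    rw [show (2 - ((N + 2 : ℕ) : ℤ)) = -N by push_cast; ring,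
      show (-1 : ℤ) = -N + N - 1 by ring, this]
    refine Finset.sum_congr rfl fun i _ => ?_
    push_cast
    rw [neg_add_eq_sub, neg_add_eq_sub]
  have h3 : √(1 - h) * ∑ k ∈ Finset.Icc (2 - ((N + 2 : ℕ) : ℤ)) 1, β k * h ^ k
      = ∑ i ∈ Finset.range (N + 2), β (i - N) * (√(1 - h) * h ^ ((i : ℝ) - N)) := by
    have := sum_Icc_int_eq_sum_range (fun k => β k * h ^ k) (-N) (N + 2)
    rw [show (2 - ((N + 2 : ℕ) : ℤ)) = -N by push_cast; ring,
      show (1 : ℤ) = -N + (N + 2 : ℕ) - 1 by push_cast; ring, this, Finset.mul_sum]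
    refine Finset.sum_congr rfl fun i _ => ?_
    rw [neg_add_eq_sub, ← rpow_intCast]
    push_cast
    ring
  have h4 : ∑ i ∈ Finset.range (N + 2), halfPowCoeff N α i * (h ^ ((i : ℝ) - N + 1 / 2) - 1)
      = (∑ i ∈ Finset.range N, α (i - N) * (h ^ ((i : ℝ) - N + 1 / 2) - 1))
        + α 1 * (h ^ ((1 : ℝ) / 2) - 1) + α 3 * (h ^ ((3 : ℝ) / 2) - 1) := by
    rw [Finset.sum_range_succ, Finset.sum_range_succ]
    have e : ∀ i ∈ Finset.range N, halfPowCoeff N α i * (h ^ ((i : ℝ) - N + 1 / 2) - 1)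
        = α (i - N) * (h ^ ((i : ℝ) - N + 1 / 2) - 1) := fun i hi => by
      rw [halfPowCoeff, if_pos (Finset.mem_range.1 hi)]
    rw [Finset.sum_congr rfl e]
    simp only [halfPowCoeff, lt_irrefl, if_false, if_true, Nat.cast_add, Nat.cast_one, sub_self,
      zero_add, show ¬ N + 1 < N by omega, show ¬ N + 1 = N by omega]
    rw [show (N : ℝ) + 1 - N + 1 / 2 = 3 / 2 by ring]
  rw [F14, F14Shift, h1, h2, h3, h4]
  ring

theorem F14Shift_one (N : ℕ) (a b : ℕ → ℝ) (c γ0 γ1 : ℝ) : F14Shift N a b c γ0 γ1 1 = 0 := by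
  simp [F14Shift]

theorem sqrt_one_sub_lt_one {h : ℝ} (h0 : 0 < h) : √(1 - h) < 1 := by
  rw [sqrt_lt' one_pos]
  linarith

theorem continuousOn_F14Shift (N : ℕ) (a b : ℕ → ℝ) (c γ0 γ1 : ℝ) :
    ContinuousOn (F14Shift N a b c γ0 γ1) (Set.Ioc 0 1) := by
  have hpow : ∀ p : ℝ, ContinuousOn (fun h : ℝ => h ^ p) (Set.Ioc 0 1) := fun p h hh =>
    (continuousAt_rpow_const h p (Or.inl hh.1.ne')).continuousWithinAt
  have hlog : ContinuousOn (fun h : ℝ => log ((1 + √(1 - h)) / (1 - √(1 - h))))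
      (Set.Ioc 0 1) := by
    refine ContinuousOn.log (ContinuousOn.div (by fun_prop) (by fun_prop) ?_) ?_
    · intro h hh
      exact (sub_pos.2 (sqrt_one_sub_lt_one hh.1)).ne'
    · intro h hh
      have h1 := sub_pos.2 (sqrt_one_sub_lt_one hh.1)
      positivity
  unfold F14Shift
  refine ContinuousOn.add (ContinuousOn.add (ContinuousOn.add ?_ (by fun_prop)) ?_)
    (ContinuousOn.mul (by fun_prop) hlog)
  · exact continuousOn_finsetSum _ fun i _ =>
      continuousOn_const.mul ((hpow _).sub continuousOn_const)
  · exact continuousOn_finsetSum _ fun i _ =>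
      continuousOn_const.mul (ContinuousOn.mul (by fun_prop) (hpow _))

theorem hasDerivAt_sqrt_one_sub {h : ℝ} (h1 : h < 1) :
    HasDerivAt (fun h : ℝ => √(1 - h)) (-1 / (2 * √(1 - h))) h :=
  ((hasDerivAt_id h).const_sub 1).sqrt (sub_pos.2 h1).ne'

theorem hasDerivAt_log_div_sqrt_one_sub {h : ℝ} (h0 : 0 < h) (h1 : h < 1) :
    HasDerivAt (fun h : ℝ => log ((1 + √(1 - h)) / (1 - √(1 - h)))) (-1 / (h * √(1 - h))) h := by
  have hs : 0 < √(1 - h) := sqrt_pos.2 (sub_pos.2 h1)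
  have hs1 : 0 < 1 - √(1 - h) := sub_pos.2 (sqrt_one_sub_lt_one h0)
  have hs2 : √(1 - h) ^ 2 = 1 - h := sq_sqrt (sub_pos.2 h1).le
  have hd := hasDerivAt_sqrt_one_sub h1
  refine (((hd.const_add 1).fun_div (hd.const_sub 1) hs1.ne').log (by positivity)).congr_deriv ?_
  set s := √(1 - h)
  have hh : h = (1 - s) * (1 + s) := by linarith [hs2]
  have h2 : (1 + s) ≠ 0 := by positivity
  have h3 := hs1.ne'
  rw [hh]
  field_simp
  ring

/-- The derivative of `F14Shift`. -/
noncomputable def F14Deriv (N : ℕ) (a b : ℕ → ℝ) (c γ0 γ1 h : ℝ) : ℝ :=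
  (∑ i ∈ Finset.range (N + 2),
      a i * (((i : ℝ) - N + 1 / 2) * h ^ ((i : ℝ) - N + 1 / 2 - 1))) + c
    + (∑ i ∈ Finset.range (N + 2),
      b i * (((i : ℝ) - N) * h ^ ((i : ℝ) - N - 1) * √(1 - h)
        - h ^ ((i : ℝ) - N) / (2 * √(1 - h))))
    + (γ1 * log ((1 + √(1 - h)) / (1 - √(1 - h))) - (γ0 + γ1 * h) / (h * √(1 - h)))

theorem hasDerivAt_F14Shift (N : ℕ) (a b : ℕ → ℝ) (c γ0 γ1 : ℝ) {h : ℝ} (h0 : 0 < h)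
    (h1 : h < 1) :
    HasDerivAt (F14Shift N a b c γ0 γ1) (F14Deriv N a b c γ0 γ1 h) h := by
  have hd := hasDerivAt_sqrt_one_sub h1
  have hpow : ∀ p : ℝ, HasDerivAt (fun h : ℝ => h ^ p) (p * h ^ (p - 1)) h := fun p =>
    hasDerivAt_rpow_const (Or.inl h0.ne')
  have hl := hasDerivAt_log_div_sqrt_one_sub h0 h1
  unfold F14Shift F14Deriv
  refine HasDerivAt.fun_add (HasDerivAt.fun_add (HasDerivAt.fun_add ?_ ?_) ?_) ?_
  · exact HasDerivAt.fun_sum fun i _ => ((hpow _).sub_const 1).const_mul (a i)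
  · simpa using ((hasDerivAt_id h).sub_const 1).const_mul c
  · refine HasDerivAt.fun_sum fun i _ => HasDerivAt.const_mul (b i) ?_
    refine (hd.fun_mul (hpow _)).congr_deriv ?_
    ring
  · refine ((((hasDerivAt_id' h).const_mul γ1).const_add γ0).fun_mul hl).congr_deriv ?_
    ring

/-- The second derivative of `F14Shift`. -/
noncomputable def F14Deriv2 (N : ℕ) (a b : ℕ → ℝ) (γ0 γ1 h : ℝ) : ℝ :=
  (∑ i ∈ Finset.range (N + 2), a i * (((i : ℝ) - N + 1 / 2) *
      (((i : ℝ) - N + 1 / 2 - 1) * h ^ ((i : ℝ) - N + 1 / 2 - 1 - 1))))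
    + (∑ i ∈ Finset.range (N + 2),
      b i * (((i : ℝ) - N) * (((i : ℝ) - N - 1) * h ^ ((i : ℝ) - N - 1 - 1)) * √(1 - h)
        - ((i : ℝ) - N) * h ^ ((i : ℝ) - N - 1) / √(1 - h)
        - h ^ ((i : ℝ) - N) / (4 * √(1 - h) ^ 3)))
    + (-2 * γ1 / (h * √(1 - h))
      + (γ0 + γ1 * h) * ((1 - h) - h / 2) / (h ^ 2 * √(1 - h) ^ 3))

theorem hasDerivAt_F14Deriv (N : ℕ) (a b : ℕ → ℝ) (c γ0 γ1 : ℝ) {h : ℝ} (h0 : 0 < h)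
    (h1 : h < 1) :
    HasDerivAt (F14Deriv N a b c γ0 γ1) (F14Deriv2 N a b γ0 γ1 h) h := by
  have hs : 0 < √(1 - h) := sqrt_pos.2 (sub_pos.2 h1)
  have hs2 : √(1 - h) ^ 2 = 1 - h := sq_sqrt (sub_pos.2 h1).le
  have hd := hasDerivAt_sqrt_one_sub h1
  have hpow : ∀ p : ℝ, HasDerivAt (fun h : ℝ => h ^ p) (p * h ^ (p - 1)) h := fun p =>
    hasDerivAt_rpow_const (Or.inl h0.ne')
  have hl := hasDerivAt_log_div_sqrt_one_sub h0 h1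
  unfold F14Deriv F14Deriv2
  refine HasDerivAt.fun_add (HasDerivAt.fun_add (HasDerivAt.add_const _ ?_) ?_) ?_
  · exact HasDerivAt.fun_sum fun i _ => ((hpow _).const_mul _).const_mul (a i)
  · refine HasDerivAt.fun_sum fun i _ => HasDerivAt.const_mul (b i) ?_
    refine ((((hpow ((i : ℝ) - N - 1)).const_mul ((i : ℝ) - N)).fun_mul hd).fun_sub
      ((hpow ((i : ℝ) - N)).fun_div (hd.const_mul 2) (by positivity))).congr_deriv ?_
    field_simp
    ring
  · refine ((hl.const_mul γ1).fun_sub ((((hasDerivAt_id' h).const_mul γ1).const_add γ0).fun_div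
      ((hasDerivAt_id' h).fun_mul hd) (by positivity))).congr_deriv ?_
    rw [show (γ0 + γ1 * h) * ((1 - h) - h / 2) = (γ0 + γ1 * h) * (√(1 - h) ^ 2 - h / 2) by rw [hs2]]
    field_simp
    ring

/-- The polynomial attached to the half-integer powers in the second derivative. -/
noncomputable def halfPowPoly (N : ℕ) (a : ℕ → ℝ) : Polynomial ℝ :=
  ∑ i ∈ Finset.range (N + 2),
    Polynomial.C (a i * (((i : ℝ) - N + 1 / 2) * ((i : ℝ) - N + 1 / 2 - 1))) * Polynomial.X ^ i

/-- The polynomial attached to the root and the logarithm in the second derivative. -/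
noncomputable def sqrtLogPoly (N : ℕ) (b : ℕ → ℝ) (γ0 γ1 : ℝ) : Polynomial ℝ :=
  (∑ i ∈ Finset.range (N + 2),
      Polynomial.C (b i * (((i : ℝ) - N) * ((i : ℝ) - N - 1))) * Polynomial.X ^ i)
    - (∑ i ∈ Finset.range (N + 2),
      Polynomial.C (b i * (((i : ℝ) - N) * (2 * ((i : ℝ) - N) - 1))) * Polynomial.X ^ i)
        * Polynomial.X ^ 1
    + (∑ i ∈ Finset.range (N + 2),
      Polynomial.C (b i * (((i : ℝ) - N) ^ 2 - 1 / 4)) * Polynomial.X ^ i) * Polynomial.X ^ 2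
    + (Polynomial.C γ0 * Polynomial.X ^ N
      - Polynomial.C (γ1 + 3 / 2 * γ0) * Polynomial.X ^ (N + 1)
      + Polynomial.C (γ1 / 2) * Polynomial.X ^ (N + 2))

theorem F14Deriv2_mul (N : ℕ) (a b : ℕ → ℝ) (γ0 γ1 : ℝ) {h : ℝ} (h0 : 0 < h) (h1 : h < 1) :
    F14Deriv2 N a b γ0 γ1 h * (h ^ (N + 2) * √(1 - h) ^ 3)
      = √h * √(1 - h) ^ 3 * (halfPowPoly N a).eval h + (sqrtLogPoly N b γ0 γ1).eval h := by
  have hs : 0 < √(1 - h) := sqrt_pos.2 (sub_pos.2 h1)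
  have hs2 : √(1 - h) ^ 2 = 1 - h := sq_sqrt (sub_pos.2 h1).le
  have hpow : ∀ i : ℕ, h ^ ((i : ℝ) - N) = h ^ i / h ^ N := fun i => by
    rw [rpow_sub h0, rpow_natCast, rpow_natCast]
  have hA : (∑ i ∈ Finset.range (N + 2), a i * (((i : ℝ) - N + 1 / 2) *
      (((i : ℝ) - N + 1 / 2 - 1) * h ^ ((i : ℝ) - N + 1 / 2 - 1 - 1))))
        * (h ^ (N + 2) * √(1 - h) ^ 3)
      = √h * √(1 - h) ^ 3 * (halfPowPoly N a).eval h := by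
    rw [halfPowPoly, Polynomial.eval_finsetSum, Finset.sum_mul, Finset.mul_sum]
    refine Finset.sum_congr rfl fun i _ => ?_
    rw [rpow_sub_one h0.ne', rpow_sub_one h0.ne', rpow_add h0, hpow, ← sqrt_eq_rpow]
    simp only [Polynomial.eval_mul, Polynomial.eval_C, Polynomial.eval_pow, Polynomial.eval_X]
    field_simp
    ring
  have hB : (∑ i ∈ Finset.range (N + 2),
      b i * (((i : ℝ) - N) * (((i : ℝ) - N - 1) * h ^ ((i : ℝ) - N - 1 - 1)) * √(1 - h)
        - ((i : ℝ) - N) * h ^ ((i : ℝ) - N - 1) / √(1 - h)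
        - h ^ ((i : ℝ) - N) / (4 * √(1 - h) ^ 3))) * (h ^ (N + 2) * √(1 - h) ^ 3)
      = (∑ i ∈ Finset.range (N + 2), b i * (((i : ℝ) - N) * ((i : ℝ) - N - 1)) * h ^ i)
        - (∑ i ∈ Finset.range (N + 2),
            b i * (((i : ℝ) - N) * (2 * ((i : ℝ) - N) - 1)) * h ^ i) * h
        + (∑ i ∈ Finset.range (N + 2), b i * (((i : ℝ) - N) ^ 2 - 1 / 4) * h ^ i) * h ^ 2 := by
    rw [Finset.sum_mul, Finset.sum_mul, Finset.sum_mul, ← Finset.sum_sub_distrib,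
      ← Finset.sum_add_distrib]
    refine Finset.sum_congr rfl fun i _ => ?_
    rw [rpow_sub_one h0.ne', rpow_sub_one h0.ne', hpow]
    generalize (i : ℝ) - N = k
    have e : b i * (k * ((k - 1) * (h ^ i / h ^ N / h / h)) * √(1 - h)
        - k * (h ^ i / h ^ N / h) / √(1 - h) - h ^ i / h ^ N / (4 * √(1 - h) ^ 3))
          * (h ^ (N + 2) * √(1 - h) ^ 3)
        = b i * h ^ i * (k * (k - 1) * (√(1 - h) ^ 2) ^ 2 - k * h * √(1 - h) ^ 2 - h ^ 2 / 4) := by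
      field_simp
      ring
    rw [e, hs2]
    ring
  have hC : (-2 * γ1 / (h * √(1 - h))
      + (γ0 + γ1 * h) * ((1 - h) - h / 2) / (h ^ 2 * √(1 - h) ^ 3)) * (h ^ (N + 2) * √(1 - h) ^ 3)
      = γ0 * h ^ N - (γ1 + 3 / 2 * γ0) * h ^ (N + 1) + γ1 / 2 * h ^ (N + 2) := by
    have e : (-2 * γ1 / (h * √(1 - h))
      + (γ0 + γ1 * h) * ((1 - h) - h / 2) / (h ^ 2 * √(1 - h) ^ 3)) * (h ^ (N + 2) * √(1 - h) ^ 3)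
      = h ^ N * (-2 * γ1 * h * √(1 - h) ^ 2 + (γ0 + γ1 * h) * ((1 - h) - h / 2)) := by
      field_simp
      ring
    rw [e, hs2]
    ring
  rw [F14Deriv2, add_mul, add_mul, hA, hB, hC, sqrtLogPoly]
  simp only [Polynomial.eval_mul, Polynomial.eval_C, Polynomial.eval_pow, Polynomial.eval_X,
    Polynomial.eval_finsetSum, Polynomial.eval_add, Polynomial.eval_sub]
  ring

theorem natDegree_sum_range_C_mul_X_pow_le (m : ℕ) (f : ℕ → ℝ) :
    (∑ i ∈ Finset.range (m + 1), Polynomial.C (f i) * Polynomial.X ^ i).natDegree ≤ m :=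
  Polynomial.natDegree_sum_le_of_forall_le _ _ fun _ hi =>
    (Polynomial.natDegree_C_mul_X_pow_le _ _).trans (Nat.lt_succ_iff.1 (Finset.mem_range.1 hi))

theorem coeff_sum_range_C_mul_X_pow (m : ℕ) (f : ℕ → ℝ) (j : ℕ) :
    (∑ i ∈ Finset.range m, Polynomial.C (f i) * Polynomial.X ^ i).coeff j =
      if j < m then f j else 0 := by
  simp [Polynomial.coeff_X_pow]

theorem natDegree_sqrtLogPoly_le (N : ℕ) (b : ℕ → ℝ) (γ0 γ1 : ℝ) :
    (sqrtLogPoly N b γ0 γ1).natDegree ≤ N + 3 := by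
  have hs := natDegree_sum_range_C_mul_X_pow_le (N + 1)
  refine Polynomial.natDegree_add_le_of_degree_le (Polynomial.natDegree_add_le_of_degree_le
    ((Polynomial.natDegree_sub_le_of_le (n := N + 3) ?_ ?_).trans (max_self _).le) ?_) ?_
  · exact (hs _).trans (by omega)
  · exact (Polynomial.natDegree_mul_le_of_le (hs _) (Polynomial.natDegree_X_pow_le 1)).trans
      (by omega)
  · exact (Polynomial.natDegree_mul_le_of_le (hs _) (Polynomial.natDegree_X_pow_le 2)).trans
      (by omega)
  · compute_degree
    all_goals omega

theorem eq_zero_of_halfPowPoly_eq_zero {N : ℕ} {a : ℕ → ℝ} (h : halfPowPoly N a = 0) :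
    ∀ i < N + 2, a i = 0 := by
  intro i hi
  have hc := congrArg (fun p => Polynomial.coeff p i) h
  simp only [halfPowPoly, coeff_sum_range_C_mul_X_pow, if_pos hi, Polynomial.coeff_zero] at hc
  refine (mul_eq_zero.1 hc).resolve_right (mul_ne_zero ?_ ?_)
  · intro h0
    have : (2 * i + 1 : ℝ) = 2 * N := by linarith
    have : 2 * i + 1 = 2 * N := by exact_mod_cast this
    omega
  · intro h0
    have : (2 * i : ℝ) = 2 * N + 1 := by linarith
    have : 2 * i = 2 * N + 1 := by exact_mod_cast this
    omega

theorem eq_zero_of_sqrtLogPoly_eq_zero {N : ℕ} {b : ℕ → ℝ} {γ0 γ1 : ℝ}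
    (h : sqrtLogPoly N b γ0 γ1 = 0) : (∀ i < N + 2, b i = 0) ∧ γ0 = 0 ∧ γ1 = 0 := by
  have hc : ∀ j, (sqrtLogPoly N b γ0 γ1).coeff j = 0 := by simp [h]
  simp only [sqrtLogPoly, Polynomial.coeff_add, Polynomial.coeff_sub, Polynomial.coeff_mul_X_pow',
    coeff_sum_range_C_mul_X_pow, Polynomial.coeff_C] at hc
  have hlow : ∀ i < N, b i = 0 := by
    intro i
    induction i using Nat.strong_induction_on with
    | _ i ih =>
      intro hi
      have hiN : (i : ℝ) < N := by exact_mod_cast hi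
      have hne : ((i : ℝ) - N) * ((i : ℝ) - N - 1) ≠ 0 :=
        mul_ne_zero (by linarith) (by linarith)
      have z1 : 1 ≤ i → b (i - 1) = 0 := fun _ => ih _ (by omega) (by omega)
      have z2 : 2 ≤ i → b (i - 2) = 0 := fun _ => ih _ (by omega) (by omega)
      refine (mul_eq_zero.1 (Eq.trans ?_ (hc i))).resolve_right hne
      rw [if_pos (by omega), if_neg (show ¬ N ≤ i by omega), if_neg (show ¬ N + 1 ≤ i by omega),
        if_neg (show ¬ N + 2 ≤ i by omega)]
      by_cases h1 : 1 ≤ i <;> by_cases h2 : 2 ≤ i <;> simp [h1, h2, z1, z2]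
  have z1 : 1 ≤ N → b (N - 1) = 0 := fun _ => hlow _ (by omega)
  have z2 : 2 ≤ N → b (N - 2) = 0 := fun _ => hlow _ (by omega)
  have hγ0 : γ0 = 0 := by
    have e := hc N
    by_cases h1 : 1 ≤ N <;> by_cases h2 : 2 ≤ N <;> simpa [h1, h2, z1, z2] using e
  have hγ1 : γ1 = 0 := by
    have e := hc (N + 1)
    by_cases h1 : 1 ≤ N <;> simpa [h1, z1, hγ0] using e
  have hb1 : b (N + 1) = 0 := by
    have e := hc (N + 3)
    rw [show N + 3 - 1 = N + 2 by omega, show N + 3 - 2 = N + 1 by omega,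
      show N + 3 - N = 3 by omega, show N + 3 - (N + 1) = 2 by omega,
      show N + 3 - (N + 2) = 1 by omega] at e
    norm_num at e
    exact e
  have hb0 : b N = 0 := by
    have e := hc (N + 2)
    norm_num [hγ0, hγ1, hb1] at e
    exact e
  refine ⟨fun i hi => ?_, hγ0, hγ1⟩
  obtain h | rfl | rfl : i < N ∨ i = N ∨ i = N + 1 := by omega
  exacts [hlow i h, hb0, hb1]

theorem card_zeros_F14Shift_le {N : ℕ} {a b : ℕ → ℝ} {c γ0 γ1 : ℝ}
    (hPQ : ¬ (halfPowPoly N a = 0 ∧ sqrtLogPoly N b γ0 γ1 = 0)) (T : Finset ℝ)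
    (hT : ∀ h ∈ T, h ∈ Set.Ioo (0 : ℝ) 1 ∧ F14Shift N a b c γ0 γ1 h = 0) :
    T.card ≤ 2 * N + 6 := by
  have h1T : (1 : ℝ) ∉ T := fun h => lt_irrefl _ (hT 1 h).1.2
  obtain ⟨T₁, hT₁, hc₁⟩ := exists_finset_zeros_deriv (f' := F14Deriv N a b c γ0 γ1)
    Set.ordConnected_Ioc (continuousOn_F14Shift N a b c γ0 γ1)
    (fun x hx => by
      rw [interior_Ioc] at hx
      exact hasDerivAt_F14Shift N a b c γ0 γ1 hx.1 hx.2)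
    (insert 1 T) (fun x hx => by
      obtain rfl | hx := Finset.mem_insert.1 hx
      · exact ⟨⟨one_pos, le_rfl⟩, F14Shift_one N a b c γ0 γ1⟩
      · exact ⟨Set.Ioo_subset_Ioc_self (hT x hx).1, (hT x hx).2⟩)
  rw [interior_Ioc] at hT₁
  have hd : ∀ x ∈ Set.Ioo (0 : ℝ) 1, HasDerivAt (F14Deriv N a b c γ0 γ1)
      (F14Deriv2 N a b γ0 γ1 x) x := fun x hx => hasDerivAt_F14Deriv N a b c γ0 γ1 hx.1 hx.2
  obtain ⟨T₂, hT₂, hc₂⟩ := exists_finset_zeros_deriv Set.ordConnected_Ioo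
    (fun x hx => (hd x hx).continuousAt.continuousWithinAt)
    (fun x hx => hd x (interior_subset hx)) T₁ hT₁
  rw [interior_Ioo] at hT₂
  have hc₃ : T₂.card ≤ 2 * N + 5 :=
    card_zeros_sqrt_mul_add_le (P := halfPowPoly N a)
      (natDegree_sum_range_C_mul_X_pow_le (N + 1) _) (natDegree_sqrtLogPoly_le N b γ0 γ1) hPQ T₂
      fun h hh => by
        obtain ⟨hI, h0⟩ := hT₂ h hh
        exact ⟨hI, by rw [← F14Deriv2_mul N a b γ0 γ1 hI.1 hI.2, h0, zero_mul]⟩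
  rw [Finset.card_insert_of_notMem h1T] at hc₁
  omega

theorem F14_add (n : ℕ) (α α' β β' : ℤ → ℝ) (γ0 γ0' γ1 γ1' h : ℝ) :
    F14 n (α + α') (β + β') (γ0 + γ0') (γ1 + γ1') h =
      F14 n α β γ0 γ1 h + F14 n α' β' γ0' γ1' h := by
  simp only [F14, Pi.add_apply, add_mul, Finset.sum_add_distrib, mul_add]
  ring

theorem F14_smul (n : ℕ) (r : ℝ) (α β : ℤ → ℝ) (γ0 γ1 h : ℝ) :
    F14 n (r • α) (r • β) (r * γ0) (r * γ1) h = r * F14 n α β γ0 γ1 h := by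
  simp only [F14, Pi.smul_apply, smul_eq_mul, mul_assoc, ← Finset.mul_sum]
  ring

/-- The evaluation of `F14` at a family of points, as a linear map of its coefficients; the
functions `α` and `β` are supported on the finite sets `A` and `B`. -/
noncomputable def F14Eval (n : ℕ) (A B : Finset ℤ) {ι : Type*} (p : ι → ℝ) :
    ((A → ℝ) × (B → ℝ) × ℝ × ℝ) →ₗ[ℝ] (ι → ℝ) where
  toFun x j := F14 n (Function.ExtendByZero.linearMap ℝ Subtype.val x.1)
    (Function.ExtendByZero.linearMap ℝ Subtype.val x.2.1) x.2.2.1 x.2.2.2 (p j)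
  map_add' x y := by
    ext j
    simp only [Prod.fst_add, Prod.snd_add, map_add, F14_add, Pi.add_apply]
  map_smul' r x := by
    ext j
    simp only [Prod.smul_fst, Prod.smul_snd, map_smul, smul_eq_mul, F14_smul, Pi.smul_apply,
      RingHom.id_apply]

/-- For `n ≥ 2` and coefficients not all zero, `F` has at most `2n+2`
zeros in `(0,1)`; moreover there is a choice of coefficients (not all zero) for which `F`
has at least `2n+2` distinct zeros in `(0,1)`. -/
theorem stmt14 (n : ℕ) (hn : 2 ≤ n) :
    (∀ α β : ℤ → ℝ, ∀ γ0 γ1 : ℝ,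
      ¬ ((∀ k ∈ Finset.Icc (1 : ℤ) 3, α k = 0) ∧
         (∀ k ∈ Finset.Icc (2 - (n : ℤ)) (-1), α k = 0) ∧
         (∀ k ∈ Finset.Icc (2 - (n : ℤ)) 1, β k = 0) ∧ γ0 = 0 ∧ γ1 = 0) →
      ∀ T : Finset ℝ,
        (∀ h ∈ T, h ∈ Set.Ioo (0 : ℝ) 1 ∧ F14 n α β γ0 γ1 h = 0) →
        T.card ≤ 2 * n + 2) ∧
    (∃ α β : ℤ → ℝ, ∃ γ0 γ1 : ℝ,
      ¬ ((∀ k ∈ Finset.Icc (1 : ℤ) 3, α k = 0) ∧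
         (∀ k ∈ Finset.Icc (2 - (n : ℤ)) (-1), α k = 0) ∧
         (∀ k ∈ Finset.Icc (2 - (n : ℤ)) 1, β k = 0) ∧ γ0 = 0 ∧ γ1 = 0) ∧
      ∃ T : Finset ℝ, T.card = 2 * n + 2 ∧
        ∀ h ∈ T, h ∈ Set.Ioo (0 : ℝ) 1 ∧ F14 n α β γ0 γ1 h = 0) := by
  obtain ⟨N, rfl⟩ := Nat.exists_eq_add_of_le' hn
  constructor
  · intro α β γ0 γ1 hne T hT
    by_cases hPQ : halfPowPoly N (halfPowCoeff N α) = 0 ∧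
        sqrtLogPoly N (fun i => β (i - N)) γ0 γ1 = 0
    · have ha := eq_zero_of_halfPowPoly_eq_zero hPQ.1
      obtain ⟨hb, rfl, rfl⟩ := eq_zero_of_sqrtLogPoly_eq_zero hPQ.2
      have hα2 : α 2 ≠ 0 := by
        intro h2
        refine hne ⟨fun k hk => ?_, fun k hk => ?_, fun k hk => ?_, rfl, rfl⟩
        · have h1 := ha N (by omega)
          have h3 := ha (N + 1) (by omega)
          simp only [halfPowCoeff, lt_irrefl, if_false, if_true] at h1
          simp only [halfPowCoeff, show ¬ N + 1 < N by omega, show ¬ N + 1 = N by omega,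
            if_false] at h3
          rw [Finset.mem_Icc] at hk
          obtain rfl | rfl | rfl : k = 1 ∨ k = 2 ∨ k = 3 := by omega
          exacts [h1, h2, h3]
        · rw [Finset.mem_Icc] at hk
          have h1 := ha (k + N).toNat (by omega)
          rw [halfPowCoeff, if_pos (by omega)] at h1
          rwa [show (((k + N).toNat : ℕ) : ℤ) - N = k by omega] at h1
        · rw [Finset.mem_Icc] at hk
          have h1 := hb (k + N).toNat (by omega)
          rwa [show (((k + N).toNat : ℕ) : ℤ) - N = k by omega] at h1
      have hTe : T = ∅ := by
        refine Finset.eq_empty_of_forall_notMem fun h hh => ?_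
        obtain ⟨hI, h0⟩ := hT h hh
        rw [F14_eq_F14Shift, F14Shift, Finset.sum_eq_zero, Finset.sum_eq_zero] at h0
        · have : h - 1 ≠ 0 := (sub_neg.2 hI.2).ne
          simp [hα2, this] at h0
        · intro i hi
          rw [hb i (Finset.mem_range.1 hi), zero_mul]
        · intro i hi
          rw [ha i (Finset.mem_range.1 hi), zero_mul]
      simp [hTe]
    · refine (card_zeros_F14Shift_le (c := α 2) hPQ T fun h hh => ?_).trans (by omega)
      rw [← F14_eq_F14Shift]
      exact hT h hh
  · set A : Finset ℤ := Finset.Icc 1 3 ∪ Finset.Icc (2 - ((N + 2 : ℕ) : ℤ)) (-1) with hA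
    set B : Finset ℤ := Finset.Icc (2 - ((N + 2 : ℕ) : ℤ)) 1 with hB
    let p : Fin (2 * (N + 2) + 2) → ℝ := fun j => 1 / ((j : ℝ) + 2)
    have hp : Function.Injective p := fun i j hij => by
      have : (i : ℝ) + 2 = j + 2 := by simpa [p] using hij
      exact Fin.ext (by exact_mod_cast add_right_cancel this)
    have hAcard : A.card = N + 3 := by
      rw [hA, Finset.card_union_of_disjoint, Int.card_Icc, Int.card_Icc]
      · omega
      · rw [Finset.disjoint_left]
        intro k hk hk'
        rw [Finset.mem_Icc] at hk hk'
        omega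
    have hBcard : B.card = N + 2 := by
      rw [hB, Int.card_Icc]
      omega
    have hker : LinearMap.ker (F14Eval (N + 2) A B p) ≠ ⊥ := by
      apply LinearMap.ker_ne_bot_of_finrank_lt
      simp only [Module.finrank_prod, Module.finrank_fintype_fun_eq_card, Fintype.card_coe,
        Fintype.card_fin, Module.finrank_self, hAcard, hBcard]
      omega
    obtain ⟨x, hx, hx0⟩ := (Submodule.ne_bot_iff _).1 hker
    have hval : ∀ (C : Finset ℤ) (f : C → ℝ) (k : C),
        Function.ExtendByZero.linearMap ℝ Subtype.val f (k : ℤ) = f k := fun C f k =>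
      Subtype.val_injective.extend_apply f 0 k
    refine ⟨Function.ExtendByZero.linearMap ℝ Subtype.val x.1,
      Function.ExtendByZero.linearMap ℝ Subtype.val x.2.1, x.2.2.1, x.2.2.2,
      fun ⟨h1, h2, h3, h4, h5⟩ => hx0 ?_, Finset.univ.image p, ?_, fun h hh => ?_⟩
    · refine Prod.ext (funext fun k => ?_) (Prod.ext (funext fun k => ?_) (Prod.ext h4 h5))
      · exact (hval A x.1 k).symm.trans ((Finset.mem_union.1 k.2).elim (h1 _) (h2 _))
      · exact (hval B x.2.1 k).symm.trans (h3 _ k.2)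
    · rw [Finset.card_image_of_injective _ hp, Finset.card_univ, Fintype.card_fin]
    · obtain ⟨j, -, rfl⟩ := Finset.mem_image.1 hh
      refine ⟨⟨by positivity, ?_⟩, congrFun hx j⟩
      rw [div_lt_one (by positivity)]
      linarith [(Nat.cast_nonneg (j : ℕ) : (0 : ℝ) ≤ (j : ℕ))]
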